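/- arXiv:2110.01545 — 3 statements merged into one kernel-verified Lean document; each statement's English description precedes it below -/
import Mathlib

section
/- Assume Λ > 0 and Δ > 0. Then the point E* = (0, σ_N θ_H/Λ, σ_C/Δ, σ_H/θ_H, σ_R/θ_R, σ_B/θ_B, 0) is an equilibrium of the tumor–immune system: substituting T = 0, N = σ_N θ_H/Λ, C = σ_C/Δ, H = σ_H/θ_H, R = σ_R/θ_R, B = σ_B/θ_B, B_T = 0 makes the right-hand side of each of the seven equations equal to zero. -/
/-- The zero-tumor point `E* = (0, σN θH/Λ, σC/Δ, σH/θH, σR/θR, σB/θB, 0)` is an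
equilibrium of the tumor–immune system: at this point the right-hand side of each of
the seven equations vanishes. -/
theorem zero_tumor_point_is_equilibrium
    (a b c d l sN sC δ lR σN θN p γN δN κ σC θC q γC r jC kC η1 η2 σH θH jH kH c1
      σR θR σB θB c2 θBT : ℝ)
    (ha : 0 < a) (hb : 0 < b) (hc : 0 < c) (hd : 0 < d) (hl : 0 < l)
    (hsN : 0 < sN) (hsC : 0 < sC) (hδ : 0 < δ) (hlR : 0 < lR)
    (hσN : 0 < σN) (hθN : 0 < θN) (hp : 0 < p) (hγN : 0 < γN) (hδN : 0 < δN)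
    (hκ : 0 < κ) (hσC : 0 < σC) (hθC : 0 < θC) (hq : 0 < q) (hγC : 0 < γC)
    (hr : 0 < r) (hjC : 0 < jC) (hkC : 0 < kC) (hη1 : 0 < η1) (hη2 : 0 < η2)
    (hσH : 0 < σH) (hθH : 0 < θH) (hjH : 0 < jH) (hkH : 0 < kH) (hc1 : 0 < c1)
    (hσR : 0 < σR) (hθR : 0 < θR) (hσB : 0 < σB) (hθB : 0 < θB) (hc2 : 0 < c2)
    (hθBT : 0 < θBT)
    (Λ Δ : ℝ)
    (hΛdef : Λ = θH * θN + θH * γN * (σR / θR) ^ δN - κ * σH)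
    (hΔdef : Δ = θC + γC * σR / θR - η1 * σH / (η2 * θH + σH))
    (hΛ : 0 < Λ) (hΔ : 0 < Δ)
    (T N C H R B BT : ℝ)
    (hT : T = 0) (hN : N = σN * θH / Λ) (hC : C = σC / Δ) (hH : H = σH / θH)
    (hR : R = σR / θR) (hB : B = σB / θB) (hBT : BT = 0) :
    a * T * (1 - b * T)
        - c * Real.exp (-(lR * R)) * (N ^ δ / (sN * T ^ δ + N ^ δ)) * T
        - d * (C ^ l / (sC * T ^ l + C ^ l)) * T = 0 ∧
    σN - θN * N - p * T * N - γN * R ^ δN * N + κ * H * N = 0 ∧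
    σC - θC * C - q * T * C - γC * R * C + r * N * T
        + (jC * T / (kC + T)) * C + (η1 * H / (η2 + H)) * C = 0 ∧
    σH - θH * H + (jH * T / (kH + T)) * B * H - c1 * H * BT = 0 ∧
    σR - θR * R + c1 * H * BT = 0 ∧
    σB - θB * B - c2 * T * B = 0 ∧
    -θBT * BT + c2 * T * B = 0 := by
  have hH' : H * θH = σH := by rw [hH]; field_simp
  have hR' : R * θR = σR := by rw [hR]; field_simp
  have hB' : B * θB = σB := by rw [hB]; field_simp
  have hN' : N * Λ = σN * θH := by rw [hN]; field_simp
  have hC' : C * Δ = σC := by rw [hC]; field_simp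
  have e1 : γC * σR / θR = γC * R := by rw [hR]; ring
  have hHpos : 0 < H := by rw [hH]; positivity
  have e2 : η1 * σH / (η2 * θH + σH) = η1 * H / (η2 + H) := by
    rw [← hH']
    field_simp
  rw [e1, e2] at hΔdef
  rw [← hR] at hΛdef
  subst hT hBT
  refine ⟨by ring, ?_, ?_, ?_, ?_, ?_, by ring⟩
  · apply mul_left_cancel₀ hθH.ne'
    rw [hΛdef] at hN'
    linear_combination (-1) * hN' + κ * N * hH'
  · rw [hΔdef] at hC'
    linear_combination (-1) * hC'
  · linear_combination (-1) * hH'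
  · linear_combination (-1) * hR'
  · linear_combination (-1) * hB'
end

section
/- Let all parameters of the tumor–immune system be positive, assume Λ ≠ 0 and Δ ≠ 0, and set A_{11} = a − c·e^{−λ_R σ_R/θ_R} − d, A_{33} = −Δ, A_{31} = σ_C θ_R (j_C − q k_C)(η_2 θ_H + σ_H) / (γ_C k_C σ_R (η_2 θ_H + σ_H) + k_C θ_R (σ_H(θ_C − η_1) + η_2 θ_C θ_H)) + r θ_H σ_N/Λ, A_{34} = η_1 η_2 σ_C θ_H² θ_R / ((η_2 θ_H + σ_H)(γ_C σ_R(η_2 θ_H + σ_H) + σ_H θ_R(θ_C − η_1) + η_2 θ_C θ_H θ_R)), where the denominators occurring in A_{31} and A_{34} are assumed nonzero. Let J be the 7×7 real matrix with rows: row 1 = (A_{11}, 0, 0, 0, 0, 0, 0); row 2 = (−p σ_N θ_H/Λ, −Λ/θ_H, 0, κ σ_N θ_H/Λ, −θ_H γ_N σ_N/(2√(σ_R/θ_R)·Λ), 0, 0); row 3 = (A_{31}, 0, A_{33}, A_{34}, γ_C σ_C/A_{33}, 0, 0); row 4 = (σ_B j_H σ_H/(θ_B θ_H k_H), 0, 0,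 −θ_H, 0, 0, −c_1 σ_H/θ_H); row 5 = (0, 0, 0, 0, −θ_R, 0, c_1 σ_H/θ_H); row 6 = (−c_2 σ_B/θ_B, 0, 0, 0, 0, −θ_B, 0); row 7 = (c_2 σ_B/θ_B, 0, 0, 0, 0, 0, −θ_{B_T}). Then the characteristic polynomial of J equals (X − A_{11})(X + Λ/θ_H)(X − A_{33})(X + θ_H)(X + θ_R)(X + θ_B)(X + θ_{B_T}); in particular, the eigenvalues of J are exactly A_{11}, −Λ/θ_H, A_{33}, −θ_H, −θ_R, −θ_B, −θ_{B_T}. -/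
open Polynomial

/-- The characteristic polynomial of the Jacobian of the tumor–immune system at the
zero-tumor equilibrium factors as
`(X - A₁₁)(X + Λ/θH)(X - A₃₃)(X + θH)(X + θR)(X + θB)(X + θBT)`;
in particular the eigenvalues of `J` are exactly
`A₁₁, -Λ/θH, A₃₃, -θH, -θR, -θB, -θBT`. -/
theorem jacobian_charpoly_zero_tumor
    (a c d lR p γN κ σN θN σC θC q γC r jC kC η1 η2 σH θH jH kH c1
      σR θR σB θB c2 θBT : ℝ)
    (ha : 0 < a) (hc : 0 < c) (hd : 0 < d) (hlR : 0 < lR) (hp : 0 < p)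
    (hγN : 0 < γN) (hκ : 0 < κ) (hσN : 0 < σN) (hθN : 0 < θN) (hσC : 0 < σC)
    (hθC : 0 < θC) (hq : 0 < q) (hγC : 0 < γC) (hr : 0 < r) (hjC : 0 < jC)
    (hkC : 0 < kC) (hη1 : 0 < η1) (hη2 : 0 < η2) (hσH : 0 < σH) (hθH : 0 < θH)
    (hjH : 0 < jH) (hkH : 0 < kH) (hc1 : 0 < c1) (hσR : 0 < σR) (hθR : 0 < θR)
    (hσB : 0 < σB) (hθB : 0 < θB) (hc2 : 0 < c2) (hθBT : 0 < θBT)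
    (Λ Δ : ℝ)
    (hΛdef : Λ = θH * θN + θH * γN * Real.sqrt (σR / θR) - κ * σH)
    (hΔdef : Δ = θC + γC * σR / θR - η1 * σH / (η2 * θH + σH))
    (hΛ : Λ ≠ 0) (hΔ : Δ ≠ 0)
    (A11 A31 A33 A34 : ℝ)
    (hA11 : A11 = a - c * Real.exp (-(lR * σR / θR)) - d)
    (hA33 : A33 = -Δ)
    (hden31 : γC * kC * σR * (η2 * θH + σH)
        + kC * θR * (σH * (θC - η1) + η2 * θC * θH) ≠ 0)
    (hA31 : A31 = σC * θR * (jC - q * kC) * (η2 * θH + σH)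
        / (γC * kC * σR * (η2 * θH + σH) + kC * θR * (σH * (θC - η1) + η2 * θC * θH))
        + r * θH * σN / Λ)
    (hden34 : (η2 * θH + σH)
        * (γC * σR * (η2 * θH + σH) + σH * θR * (θC - η1) + η2 * θC * θH * θR) ≠ 0)
    (hA34 : A34 = η1 * η2 * σC * θH ^ 2 * θR
        / ((η2 * θH + σH)
          * (γC * σR * (η2 * θH + σH) + σH * θR * (θC - η1) + η2 * θC * θH * θR)))
    (J : Matrix (Fin 7) (Fin 7) ℝ)
    (hJ : J = Matrix.of
      ![![A11, 0, 0, 0, 0, 0, 0],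
        ![-(p * σN * θH / Λ), -(Λ / θH), 0, κ * σN * θH / Λ,
          -(θH * γN * σN / (2 * Real.sqrt (σR / θR) * Λ)), 0, 0],
        ![A31, 0, A33, A34, γC * σC / A33, 0, 0],
        ![σB * jH * σH / (θB * θH * kH), 0, 0, -θH, 0, 0, -(c1 * σH / θH)],
        ![0, 0, 0, 0, -θR, 0, c1 * σH / θH],
        ![-(c2 * σB / θB), 0, 0, 0, 0, -θB, 0],
        ![c2 * σB / θB, 0, 0, 0, 0, 0, -θBT]]) :
    J.charpoly =
      (X - C A11) * (X + C (Λ / θH)) * (X - C A33) * (X + C θH) * (X + C θR)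
        * (X + C θB) * (X + C θBT) ∧
    spectrum ℝ J = {A11, -(Λ / θH), A33, -θH, -θR, -θB, -θBT} := by
  have h1 : J.charpoly =
      (X - C A11) * (X + C (Λ / θH)) * (X - C A33) * (X + C θH) * (X + C θR)
        * (X + C θB) * (X + C θBT) := by
    clear hA11 hA33 hA31 hA34 hΛdef hΔdef
    rw [← Matrix.charpoly_reindex (finRotate 7).symm J, Matrix.charpoly_of_upperTriangular]
    · subst hJ
      simp [Fin.prod_univ_succ, finRotate_apply, Fin.ext_iff, Fin.succ]
      ring
    · intro i j hij
      subst hJ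
      fin_cases i <;> fin_cases j <;> first | rfl | (exfalso; revert hij; decide)
  refine ⟨h1, ?_⟩
  ext x
  rw [Matrix.mem_spectrum_iff_isRoot_charpoly, h1]
  simp only [Polynomial.IsRoot.def, eval_mul, eval_add, eval_sub, eval_X, eval_C, mul_eq_zero,
    sub_eq_zero, add_eq_zero_iff_eq_neg, Set.mem_insert_iff, Set.mem_singleton_iff, or_assoc]
end

section
/- Let s > 0 and let n be a real number with 0 < n ≤ 1. Then the Hill function h(x) = x^n/(s + x^n) is concave on (0, ∞); that is, the lysis curve has hyperbolic (saturating, non-sigmoid) shape for Hill coefficients at most 1. -/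
/-- For Hill coefficient `0 < n ≤ 1` and `s > 0`, the Hill function
`h(x) = x^n/(s + x^n)` is concave on `(0, ∞)`: the lysis curve is hyperbolic
(saturating, non-sigmoid). -/
theorem hill_concave_of_exponent_le_one
    (s n : ℝ) (hs : 0 < s) (hn0 : 0 < n) (hn1 : n ≤ 1) :
    ConcaveOn ℝ (Set.Ioi (0 : ℝ)) (fun x : ℝ => x ^ n / (s + x ^ n)) := by
  refine ⟨convex_Ioi 0, ?_⟩
  intro x hx y hy a b ha hb hab
  have hx0 : 0 < x := hx
  have hy0 : 0 < y := hy
  have hc := (Real.concaveOn_rpow hn0.le hn1).2 (Set.mem_Ici.2 hx0.le) (Set.mem_Ici.2 hy0.le) ha hb hab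
  simp only [smul_eq_mul] at hc ⊢
  have hu : 0 < x ^ n := Real.rpow_pos_of_pos hx0 n
  have hv : 0 < y ^ n := Real.rpow_pos_of_pos hy0 n
  generalize x ^ n = u at *
  generalize y ^ n = v at *
  generalize (a * x + b * y) ^ n = w at *
  have hm : 0 ≤ a * u + b * v := by positivity
  have hw : 0 ≤ w := hm.trans hc
  have h2 : (a * u + b * v) / (s + (a * u + b * v)) ≤ w / (s + w) := by
    rw [div_le_div_iff₀ (by positivity) (by positivity)]
    nlinarith
  refine le_trans ?_ h2
  obtain rfl : b = 1 - a := by linarith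
  have key : (a * u + (1 - a) * v) / (s + (a * u + (1 - a) * v))
      - (a * (u / (s + u)) + (1 - a) * (v / (s + v)))
      = s * a * (1 - a) * (u - v) ^ 2
        / ((s + u) * (s + v) * (s + (a * u + (1 - a) * v))) := by
    have h1 : s + u ≠ 0 := by positivity
    have h2 : s + v ≠ 0 := by positivity
    have h3 : s + (a * u + (1 - a) * v) ≠ 0 := by positivity
    rw [eq_div_iff (by positivity)]
    generalize hM : s + (a * u + (1 - a) * v) = M at *
    field_simp
    subst hM
    ring
  have : 0 ≤ s * a * (1 - a) * (u - v) ^ 2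
        / ((s + u) * (s + v) * (s + (a * u + (1 - a) * v))) := by positivity
  linarith
end
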